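/- Let w ∈ Σ_n and let γ be an increasing chain in the labeled Bruhat order from w to the longest permutation w₀. Then the set {(k,b) : k,b ≥ 1, k+b ≤ n, and (k,b) is not a label of a cover in γ} is an rc-graph associated to w. -/

import Mathlib

open MvPolynomial

noncomputable section

/-- The symmetric group `Σ_n` on `{0, …, n-1}` (0-indexed model of `{1, …, n}`). -/
abbrev Perm' (n : ℕ) := Equiv.Perm (Fin n)

/-- The length `ℓ(w)`: the number of inversions of `w`. -/
def invLength {n : ℕ} (w : Perm' n) : ℕ :=
  (Finset.univ.filter (fun p : Fin n × Fin n => p.1 < p.2 ∧ w p.2 < w p.1)).card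

/-- The longest permutation `w₀ = n … 2 1`. -/
def w0 (n : ℕ) : Perm' n := Fin.revPerm

/-- `u ⋖ w` in the Bruhat order: `w = u·(k,l)` where `k < l`, `u k < u l`, and no
position strictly between `k` and `l` has a `u`-value between `u k` and `u l`. -/
def BruhatCover {n : ℕ} (u w : Perm' n) : Prop :=
  ∃ k l : Fin n, k < l ∧ u k < u l ∧
    (∀ i : Fin n, k < i → i < l → ¬(u k < u i ∧ u i < u l)) ∧
    w = u * Equiv.swap k l

/-- The Bruhat order, generated by its covers. -/
def BruhatLE {n : ℕ} : Perm' n → Perm' n → Prop :=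
  Relation.ReflTransGen BruhatCover

/-- `u →^{(k,b)} w` is a labeled cover in the labeled Bruhat order (0-indexed):
`u ⋖ w` with `u⁻¹w = (i,j)`, `i ≤ k < j` and `b = u i`. -/
def IsLabeledCover {n : ℕ} (u w : Perm' n) (k b : ℕ) : Prop :=
  ∃ i j : Fin n, i < j ∧ u i < u j ∧
    (∀ m : Fin n, i < m → m < j → ¬(u i < u m ∧ u m < u j)) ∧
    w = u * Equiv.swap i j ∧ (i : ℕ) ≤ k ∧ k < (j : ℕ) ∧ b = (u i : ℕ)

/-- Strict lexicographic order on labels `(k,b)`. -/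
def lexLt (p q : ℕ × ℕ) : Prop := p.1 < q.1 ∨ (p.1 = q.1 ∧ p.2 < q.2)

/-- A saturated labeled chain of length `m` from `u` to `w` in the labeled Bruhat order. -/
structure LabeledChain (n m : ℕ) (u w : Perm' n) where
  c : Fin (m + 1) → Perm' n
  lab : Fin m → ℕ × ℕ
  c_zero : c 0 = u
  c_last : c (Fin.last m) = w
  step : ∀ i : Fin m, IsLabeledCover (c i.castSucc) (c i.succ) (lab i).1 (lab i).2

/-- A chain is increasing if its labels strictly increase in lexicographic order. -/
def LabeledChain.Increasing {n m : ℕ} {u w : Perm' n} (γ : LabeledChain n m u w) : Prop :=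
  ∀ i j : Fin m, i < j → lexLt (γ.lab i) (γ.lab j)

/-- The type of a chain: `α_k` counts labels with first coordinate `k`. -/
def chainType {n m : ℕ} {u w : Perm' n} (γ : LabeledChain n m u w) : Fin n → ℕ :=
  fun k => (Finset.univ.filter (fun i : Fin m => (γ.lab i).1 = (k : ℕ))).card

/-- `I_α(u,w)`: the number of increasing chains from `u` to `w` of type `α`. -/
def incChainCount (n : ℕ) (u w : Perm' n) (α : Fin n → ℕ) : ℕ :=
  Nat.card ((m : ℕ) × {γ : LabeledChain n m u w // γ.Increasing ∧ chainType γ = α})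

/-- The staircase monomial `x^δ = x₁^{n-1} x₂^{n-2} ⋯ x_{n-1}`. -/
def xDelta (n : ℕ) : MvPolynomial (Fin n) ℤ :=
  ∏ i : Fin n, X i ^ (n - 1 - (i : ℕ))

/-- `S` is the family of Schubert polynomials: `S w₀ = x^δ` and
`S w - s_i·(S w) = (x_i - x_{i+1}) · S (w s_i)` whenever `ℓ(w s_i) < ℓ(w)`. -/
def IsSchubertFamily (n : ℕ) (S : Perm' n → MvPolynomial (Fin n) ℤ) : Prop :=
  S (w0 n) = xDelta n ∧
  ∀ (w : Perm' n) (i : ℕ) (h : i + 1 < n),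
    invLength (w * Equiv.swap (⟨i, by omega⟩ : Fin n) ⟨i + 1, h⟩) < invLength w →
    S w - rename (Equiv.swap (⟨i, by omega⟩ : Fin n) ⟨i + 1, h⟩) (S w) =
      (X (⟨i, by omega⟩ : Fin n) - X ⟨i + 1, h⟩) *
        S (w * Equiv.swap (⟨i, by omega⟩ : Fin n) ⟨i + 1, h⟩)

/-- The ideal generated by the elementary symmetric polynomials `e₁, …, e_n`. -/
def symIdeal (n : ℕ) : Ideal (MvPolynomial (Fin n) ℤ) :=
  Ideal.span ((fun k => esymm (Fin n) ℤ k) '' Set.Icc 1 n)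

/-- `g` is the normal form of `f` modulo the ideal of elementary symmetric polynomials :
`f ≡ g` and every monomial of `g` divides `x^δ`.  (For the degree reverse lexicographic
term order with `x₁ < ⋯ < x_n`, the normal form is exactly the unique such `g`.) -/
def IsNormalForm (n : ℕ) (f g : MvPolynomial (Fin n) ℤ) : Prop :=
  f - g ∈ symIdeal n ∧ ∀ d ∈ g.support, ∀ i : Fin n, d i ≤ n - 1 - (i : ℕ)

def finSubEquiv {n N : ℕ} (h : n ≤ N) : Fin n ≃ {i : Fin N // (i : ℕ) < n} where
  toFun i := ⟨Fin.castLE h i, i.isLt⟩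
  invFun j := ⟨(j.1 : ℕ), j.2⟩
  left_inv i := rfl
  right_inv j := rfl

/-- The standard inclusion `Σ_n ⊂ Σ_N`, extending a permutation by fixed points. -/
def permIncl {n N : ℕ} (h : n ≤ N) (u : Perm' n) : Perm' N :=
  u.extendDomain (finSubEquiv h)

/-- `δ` as an exponent vector. -/
def deltaF (n : ℕ) : Fin n →₀ ℕ :=
  Finsupp.equivFunOnFinite.symm fun i => n - 1 - (i : ℕ)

/-- The type of a chain as an exponent vector. -/
def chainTypeF {n m : ℕ} {u w : Perm' n} (γ : LabeledChain n m u w) : Fin n →₀ ℕ :=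
  Finsupp.equivFunOnFinite.symm (chainType γ)

/-- `δ` as an integral exponent vector. -/
def deltaZ (n : ℕ) : Fin n →₀ ℤ :=
  Finsupp.equivFunOnFinite.symm fun i => ((n - 1 - (i : ℕ) : ℕ) : ℤ)

/-- The type of a chain as an integral exponent vector. -/
def chainTypeZ {n m : ℕ} {u w : Perm' n} (γ : LabeledChain n m u w) : Fin n →₀ ℤ :=
  Finsupp.equivFunOnFinite.symm fun k => ((chainType γ k : ℕ) : ℤ)

/-- The inclusion of polynomials into Laurent polynomials. -/
def toLaurent (n : ℕ) : MvPolynomial (Fin n) ℤ →+* AddMonoidAlgebra ℤ (Fin n →₀ ℤ) :=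
  AddMonoidAlgebra.mapDomainRingHom ℤ (Finsupp.mapRange.addMonoidHom (Nat.castAddMonoidHom ℤ))

/-- The complete homogeneous symmetric polynomial `h_a(x₁, …, x_k)` inside
`ℤ[x₁, …, x_n]` (variables are 0-indexed, so the first `k` variables are used). -/
def hpoly (n k a : ℕ) : MvPolynomial (Fin n) ℤ :=
  ∑ s ∈ (Finset.univ.filter (fun i : Fin n => (i : ℕ) < k)).sym a,
    ((s : Multiset (Fin n)).map X).prod

/-- `h_α = h_{α₁}(x₁) h_{α₂}(x₁,x₂) ⋯ h_{α_{n-1}}(x₁, …, x_{n-1})` (0-indexed `α`). -/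
def hAlpha (n : ℕ) (α : Fin n → ℕ) : MvPolynomial (Fin n) ℤ :=
  ∏ i : Fin n, hpoly n ((i : ℕ) + 1) (α i)

/- ## rc-graphs (0-indexed pairs: the paper's pair `(k,b)` is `(k-1, b-1)`) -/

/-- The linear order on rc-graph positions: `(k,b) ≤ (j,a)  ⇔  k < j, or k = j and b ≥ a`. -/
def rcLE (p q : ℕ × ℕ) : Prop := p.1 < q.1 ∨ (p.1 = q.1 ∧ q.2 ≤ p.2)

instance : DecidableRel rcLE := fun p q => by unfold rcLE; exact inferInstance
instance : IsTrans (ℕ × ℕ) rcLE :=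
  ⟨fun a b c h1 h2 => by unfold rcLE at h1 h2 ⊢; omega⟩
instance : IsAntisymm (ℕ × ℕ) rcLE :=
  ⟨fun a b h1 h2 => by unfold rcLE at h1 h2; rw [Prod.ext_iff]; omega⟩
instance : IsTotal (ℕ × ℕ) rcLE := ⟨fun a b => by unfold rcLE; omega⟩

/-- The adjacent transposition `s_{i+1} = (i, i+1)` (0-indexed positions). -/
def adjT (n : ℕ) (i : ℕ) : Perm' n :=
  if h : i + 1 < n then Equiv.swap ⟨i, by omega⟩ ⟨i + 1, h⟩ else 1

/-- The word `d(R)` of a set of positions: list its elements in the order `rcLE` and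
record `k + b` for each pair (0-indexed version of `k + b - 1`). -/
def rcWord (R : Finset (ℕ × ℕ)) : List ℕ :=
  (R.sort rcLE).map (fun p => p.1 + p.2)

/-- The permutation given by a word in the adjacent transpositions. -/
def wordPerm (n : ℕ) (l : List ℕ) : Perm' n :=
  (l.map (adjT n)).prod

/-- The permutation of a set of rc-positions. -/
def rcPerm (n : ℕ) (R : Finset (ℕ × ℕ)) : Perm' n := wordPerm n (rcWord R)

/-- `R` consists of valid rc-positions: (0-indexed) `k + b + 2 ≤ n`. -/
def IsRC (n : ℕ) (R : Finset (ℕ × ℕ)) : Prop := ∀ p ∈ R, p.1 + p.2 + 2 ≤ n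

/-- `R ∈ 𝓡(w)`: `R` is an rc-graph associated to `w`, i.e. `d(R)` is a reduced word for `w`. -/
def AssocRC (n : ℕ) (R : Finset (ℕ × ℕ)) (w : Perm' n) : Prop :=
  IsRC n R ∧ rcPerm n R = w ∧ R.card = invLength w

/-- All valid rc-positions for `Σ_n`. -/
def fullRC (n : ℕ) : Finset (ℕ × ℕ) :=
  (Finset.range n ×ˢ Finset.range n).filter (fun p => p.1 + p.2 + 2 ≤ n)

/-- One greedy step: adjoin the lexicographically smallest valid pair not in `R`. -/
def GreedyStep (n : ℕ) (R R' : Finset (ℕ × ℕ)) : Prop :=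
  ∃ p : ℕ × ℕ, p ∉ R ∧ p.1 + p.2 + 2 ≤ n ∧
    (∀ q : ℕ × ℕ, q.1 + q.2 + 2 ≤ n → q ∉ R → (p.1 < q.1 ∨ (p.1 = q.1 ∧ p.2 ≤ q.2))) ∧
    R' = insert p R

/-- The exponent of `x_i` in `x^R`. -/
def rcType (n : ℕ) (R : Finset (ℕ × ℕ)) : Fin n → ℕ :=
  fun i => (R.filter (fun p => p.1 = (i : ℕ))).card

/-- `γ = γ(R)`: the chain `γ` is produced from `R` by the greedy sequence. -/
def GreedyRel (n : ℕ) {m : ℕ} (w : Perm' n) (R : Finset (ℕ × ℕ))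
    (γ : LabeledChain n m w (w0 n)) : Prop :=
  ∃ Rs : ℕ → Finset (ℕ × ℕ), Rs 0 = R ∧
    (∀ i < m, GreedyStep n (Rs i) (Rs (i + 1))) ∧
    (∀ i : Fin m, γ.lab i ∉ Rs (i : ℕ) ∧ Rs ((i : ℕ) + 1) = insert (γ.lab i) (Rs (i : ℕ))) ∧
    (∀ i : Fin (m + 1), rcPerm n (Rs (i : ℕ)) = γ.c i)

theorem rcPerm_union {n : ℕ} {A B : Finset (ℕ × ℕ)}
    (h : ∀ p ∈ A, ∀ q ∈ B, rcLE p q ∧ p ≠ q) :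
    rcPerm n (A ∪ B) = rcPerm n A * rcPerm n B := by
  have hs : (A ∪ B).sort rcLE = A.sort rcLE ++ B.sort rcLE := by
    have hnd : (A.sort rcLE ++ B.sort rcLE).Nodup := by
      rw [List.nodup_append]
      refine ⟨A.sort_nodup rcLE, B.sort_nodup rcLE, fun p hp q hq => ?_⟩
      rw [Finset.mem_sort] at hp hq
      exact (h p hp q hq).2
    have hu : A ∪ B = (A.sort rcLE ++ B.sort rcLE).toFinset := by
      simp [List.toFinset_append]
    rw [hu, List.toFinset_sort rcLE hnd, List.pairwise_append]
    refine ⟨A.pairwise_sort rcLE, B.pairwise_sort rcLE, fun p hp q hq => ?_⟩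
    rw [Finset.mem_sort] at hp hq
    exact (h p hp q hq).1
  simp [rcPerm, rcWord, wordPerm, hs]

theorem rcPerm_singleton (n : ℕ) (p : ℕ × ℕ) : rcPerm n {p} = adjT n (p.1 + p.2) := by
  simp [rcPerm, rcWord, wordPerm]

theorem rcPerm_empty (n : ℕ) : rcPerm n ∅ = 1 := by
  simp [rcPerm, rcWord, wordPerm]

theorem adjT_apply_left {n i : ℕ} (h : i + 1 < n) {x : Fin n} (hx : (x : ℕ) = i) :
    (adjT n i x : ℕ) = i + 1 := by
  subst hx
  simp [adjT, h]

theorem adjT_apply_right {n i : ℕ} (h : i + 1 < n) {x : Fin n} (hx : (x : ℕ) = i + 1) :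
    (adjT n i x : ℕ) = i := by
  obtain rfl : x = ⟨i + 1, h⟩ := Fin.ext hx
  simp [adjT, h]

theorem adjT_apply_of_ne {n i : ℕ} {x : Fin n} (h₁ : (x : ℕ) ≠ i) (h₂ : (x : ℕ) ≠ i + 1) :
    adjT n i x = x := by
  unfold adjT
  split_ifs with h
  · exact Equiv.swap_apply_of_ne_of_ne (fun e => h₁ (by simp [e])) (fun e => h₂ (by simp [e]))
  · rfl

theorem rcPerm_apply_of_forall_ne {n : ℕ} {R : Finset (ℕ × ℕ)} {x : Fin n}
    (h : ∀ p ∈ R, (x : ℕ) ≠ p.1 + p.2 ∧ (x : ℕ) ≠ p.1 + p.2 + 1) : rcPerm n R x = x := by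
  have aux : ∀ l : List (ℕ × ℕ),
      (∀ p ∈ l, (x : ℕ) ≠ p.1 + p.2 ∧ (x : ℕ) ≠ p.1 + p.2 + 1) →
      wordPerm n (l.map (fun p => p.1 + p.2)) x = x := by
    intro l
    induction l with
    | nil => intro _; simp [wordPerm]
    | cons p l ih =>
      intro hl
      have h₁ := ih (fun q hq => hl q (List.mem_cons_of_mem _ hq))
      have h₂ := hl p List.mem_cons_self
      simp only [wordPerm, List.map_cons, List.prod_cons, Equiv.Perm.mul_apply] at h₁ ⊢
      rw [h₁, adjT_apply_of_ne h₂.1 h₂.2]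
  exact aux _ (fun p hp => h p ((Finset.mem_sort rcLE).1 hp))

/-- The initial segment `(k,0), …, (k,b-1)` of the `k`-th row. -/
def rowSeg (k b : ℕ) : Finset (ℕ × ℕ) := (Finset.range b).image (Prod.mk k)

theorem mem_rowSeg {k b : ℕ} {p : ℕ × ℕ} : p ∈ rowSeg k b ↔ p.1 = k ∧ p.2 < b := by
  obtain ⟨i, j⟩ := p
  simp only [rowSeg, Finset.mem_image, Finset.mem_range, Prod.mk.injEq]
  exact ⟨fun ⟨a, ha, h₁, h₂⟩ => ⟨h₁.symm, h₂ ▸ ha⟩, fun ⟨h₁, h₂⟩ => ⟨j, h₂, h₁.symm, rfl⟩⟩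

theorem rcPerm_rowSeg_succ (n k b : ℕ) :
    rcPerm n (rowSeg k (b + 1)) = adjT n (k + b) * rcPerm n (rowSeg k b) := by
  have hu : rowSeg k (b + 1) = {(k, b)} ∪ rowSeg k b := by
    ext ⟨i, j⟩
    simp only [mem_rowSeg, Finset.mem_union, Finset.mem_singleton, Prod.mk.injEq]
    omega
  rw [hu, rcPerm_union, rcPerm_singleton]
  rintro p hp ⟨i, j⟩ hq
  rw [Finset.mem_singleton] at hp
  rw [mem_rowSeg] at hq
  subst hp
  simp only [rcLE, ne_eq, Prod.mk.injEq] at hq ⊢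
  omega

theorem rcPerm_rowSeg_apply_self {n k : ℕ} (b : ℕ) (h : k + b < n) {x : Fin n}
    (hx : (x : ℕ) = k) : (rcPerm n (rowSeg k b) x : ℕ) = k + b := by
  induction b with
  | zero => simpa [rowSeg, rcPerm_empty] using hx
  | succ b ih =>
    rw [rcPerm_rowSeg_succ, Equiv.Perm.mul_apply, adjT_apply_left (by omega) (ih (by omega))]
    omega

theorem rcPerm_rowSeg_apply_of_gt {n k b : ℕ} {x : Fin n} (hx : k + b < x) :
    rcPerm n (rowSeg k b) x = x := by
  refine rcPerm_apply_of_forall_ne fun p hp => ?_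
  rw [mem_rowSeg] at hp
  omega

theorem rcPerm_rowSeg_apply_of_lt {n k b : ℕ} {x : Fin n} (hx : (x : ℕ) < k) :
    rcPerm n (rowSeg k b) x = x := by
  refine rcPerm_apply_of_forall_ne fun p hp => ?_
  rw [mem_rowSeg] at hp
  omega

theorem rcPerm_rowSeg_apply_of_le {n k : ℕ} (b : ℕ) {x : Fin n} (hk : k < x)
    (hx : (x : ℕ) ≤ k + b) : (rcPerm n (rowSeg k b) x : ℕ) = x - 1 := by
  induction b with
  | zero => omega
  | succ b ih =>
    have hn := x.isLt
    rw [rcPerm_rowSeg_succ, Equiv.Perm.mul_apply]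
    rcases Nat.lt_or_ge (k + b) x with h | h
    · rw [rcPerm_rowSeg_apply_of_gt h, adjT_apply_right (by omega) (by omega)]
      omega
    · have h' := ih h
      rw [adjT_apply_of_ne (by omega) (by omega), h']

/-- The first `k` rows of the full set of positions. -/
def topRows (n k : ℕ) : Finset (ℕ × ℕ) := (fullRC n).filter (fun p => p.1 < k)

theorem mem_fullRC {n : ℕ} {p : ℕ × ℕ} : p ∈ fullRC n ↔ p.1 + p.2 + 2 ≤ n := by
  simp only [fullRC, Finset.mem_filter, Finset.mem_product, Finset.mem_range]
  omega

theorem mem_topRows {n k : ℕ} {p : ℕ × ℕ} :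
    p ∈ topRows n k ↔ p.1 + p.2 + 2 ≤ n ∧ p.1 < k := by
  simp [topRows, mem_fullRC]

theorem rcPerm_topRows_apply {n : ℕ} (k : ℕ) (hk : k ≤ n) (x : Fin n) :
    (rcPerm n (topRows n k) x : ℕ) = if (x : ℕ) < k then n - 1 - x else x - k := by
  induction k generalizing x with
  | zero => simp [topRows, rcPerm_empty]
  | succ k ih =>
    have hu : topRows n (k + 1) = topRows n k ∪ rowSeg k (n - 1 - k) := by
      ext p
      simp only [mem_topRows, mem_rowSeg, Finset.mem_union]
      omega
    have hx := x.isLt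
    rw [hu, rcPerm_union, Equiv.Perm.mul_apply, ih (by omega)]
    · rcases Nat.lt_trichotomy x k with h | h | h
      · rw [rcPerm_rowSeg_apply_of_lt h, if_pos h, if_pos (by omega)]
      · rw [rcPerm_rowSeg_apply_self _ (by omega) h, if_neg (by omega), if_pos (by omega)]
        omega
      · rw [rcPerm_rowSeg_apply_of_le _ h (by omega), if_neg (by omega), if_neg (by omega)]
        omega
    · rintro ⟨i, j⟩ hp ⟨i', j'⟩ hq
      simp only [mem_topRows, mem_rowSeg, rcLE, ne_eq, Prod.mk.injEq] at *
      omega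

theorem rcPerm_fullRC (n : ℕ) : rcPerm n (fullRC n) = w0 n := by
  have h : fullRC n = topRows n n := by
    ext p
    rw [mem_fullRC, mem_topRows]
    omega
  ext x
  rw [h, rcPerm_topRows_apply n le_rfl, if_pos x.isLt, w0, Fin.revPerm_apply, Fin.val_rev]
  omega

/-- Removing from `S` a position all of whose lexicographic predecessors are in `S` multiplies the
permutation by the transposition of the position `k` with the place where `b` occurs. -/
theorem rcPerm_erase {n k b : ℕ} {S : Finset (ℕ × ℕ)} (hS : IsRC n S) (hb : k + b + 2 ≤ n)
    (hp : (k, b) ∈ S) (hlex : ∀ q ∈ fullRC n, lexLt q (k, b) → q ∈ S)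
    {x y : Fin n} (hx : (x : ℕ) = k) (hy : (rcPerm n S y : ℕ) = b) :
    rcPerm n (S.erase (k, b)) = rcPerm n S * Equiv.swap x y := by
  set a := rcPerm n (S.filter (fun p => p.1 = k ∧ b < p.2)) with ha
  set c := rcPerm n (S.filter (fun p => k < p.1)) with hc
  set f := rcPerm n (topRows n k) with hf
  set r := rcPerm n (rowSeg k b) with hr
  have hBelow : rcPerm n (rowSeg k b ∪ S.filter (fun p => k < p.1)) = r * c := by
    apply rcPerm_union
    rintro ⟨i, j⟩ hi ⟨i', j'⟩ hi'
    simp only [mem_rowSeg, Finset.mem_filter, rcLE, ne_eq, Prod.mk.injEq] at *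
    omega
  have hAbove : rcPerm n (topRows n k ∪ S.filter (fun p => p.1 = k ∧ b < p.2)) = f * a := by
    apply rcPerm_union
    rintro ⟨i, j⟩ hi ⟨i', j'⟩ hi'
    simp only [mem_topRows, Finset.mem_filter, rcLE, ne_eq, Prod.mk.injEq] at *
    omega
  have hErase : rcPerm n (S.erase (k, b)) = f * a * (r * c) := by
    rw [← hBelow, ← hAbove, ← rcPerm_union]
    · congr 1
      ext ⟨i, j⟩
      have h₁ := hS (i, j)
      have h₂ := hlex (i, j)
      simp only [mem_topRows, mem_fullRC, mem_rowSeg, Finset.mem_union, Finset.mem_filter,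
        Finset.mem_erase, lexLt, ne_eq, Prod.mk.injEq] at *
      constructor
      · rintro ⟨h, h'⟩
        have := h₁ h'
        simp only [h', true_and]
        omega
      · rintro ((h | h) | (h | h))
        · exact ⟨by omega, h₂ (by omega) (by omega)⟩
        · exact ⟨by omega, h.1⟩
        · exact ⟨by omega, h₂ (by omega) (by omega)⟩
        · exact ⟨by omega, h.1⟩
    · rintro ⟨i, j⟩ hi ⟨i', j'⟩ hi'
      simp only [mem_topRows, mem_rowSeg, Finset.mem_union, Finset.mem_filter, rcLE, ne_eq,
        Prod.mk.injEq] at *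
      omega
  have hFull : rcPerm n S = f * a * (adjT n (k + b) * (r * c)) := by
    have hpt : rcPerm n ({(k, b)} ∪ (rowSeg k b ∪ S.filter (fun p => k < p.1))) =
        adjT n (k + b) * (r * c) := by
      rw [rcPerm_union, rcPerm_singleton, hBelow]
      rintro ⟨i, j⟩ hi ⟨i', j'⟩ hi'
      simp only [mem_rowSeg, Finset.mem_union, Finset.mem_filter, Finset.mem_singleton, rcLE,
        ne_eq, Prod.mk.injEq] at *
      omega
    rw [← hpt, ← hAbove, ← rcPerm_union]
    · congr 1
      ext ⟨i, j⟩
      have h₁ := hS (i, j)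
      have h₂ := hlex (i, j)
      simp only [mem_topRows, mem_fullRC, mem_rowSeg, Finset.mem_union, Finset.mem_filter,
        Finset.mem_singleton, lexLt, Prod.mk.injEq] at *
      constructor
      · intro h'
        have := h₁ h'
        simp only [h', true_and]
        omega
      · rintro ((h | h) | h | h | h)
        · exact h₂ (by omega) (by omega)
        · exact h.1
        · rwa [h.1, h.2]
        · exact h₂ (by omega) (by omega)
        · exact h.1
    · rintro ⟨i, j⟩ hi ⟨i', j'⟩ hi'
      simp only [mem_topRows, mem_rowSeg, Finset.mem_union, Finset.mem_filter,
        Finset.mem_singleton, rcLE, ne_eq, Prod.mk.injEq] at *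
      omega
  have hcx : c x = x := rcPerm_apply_of_forall_ne fun p hp => by
    rw [Finset.mem_filter] at hp
    omega
  have hrx : (r * c) x = ⟨k + b, by omega⟩ := by
    rw [Equiv.Perm.mul_apply, hcx]
    exact Fin.ext (rcPerm_rowSeg_apply_self b (by omega) hx)
  have hry : (r * c) y = ⟨k + b + 1, by omega⟩ := by
    set z : Fin n := ⟨k + b, by omega⟩ with hz
    have haz : a z = z := rcPerm_apply_of_forall_ne fun p hp => by
      rw [Finset.mem_filter] at hp
      simp only [hz]
      omega
    have hfz : (f z : ℕ) = b := by
      rw [hf, rcPerm_topRows_apply k (by omega), if_neg (by simp [hz])]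
      simp [hz]
    have h₁ : (f * a) (adjT n (k + b) ((r * c) y)) = (f * a) z := by
      apply Fin.ext
      have h₀ : (f * a) (adjT n (k + b) ((r * c) y)) = rcPerm n S y := by rw [hFull]; rfl
      rw [h₀, Equiv.Perm.mul_apply f a z, haz, hfz, hy]
    have h₂ := (f * a).injective h₁
    have h₃ : adjT n (k + b) ⟨k + b + 1, by omega⟩ = z :=
      Fin.ext (adjT_apply_right (by omega) rfl)
    exact (adjT n (k + b)).injective (h₂.trans h₃.symm)
  have hadj : adjT n (k + b) = Equiv.swap ⟨k + b, by omega⟩ ⟨k + b + 1, by omega⟩ := by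
    rw [adjT, dif_pos (by omega)]
  rw [hErase, hFull, mul_assoc (f * a), mul_assoc (adjT n (k + b)),
    Equiv.mul_swap_eq_swap_mul (r * c), hrx, hry, hadj, ← mul_assoc (Equiv.swap _ _),
    Equiv.swap_mul_self, one_mul]

theorem invLength_w0 (n : ℕ) : invLength (w0 n) = (fullRC n).card := by
  symm
  refine Finset.card_bij'
    (fun p hp => ((⟨p.1, by rw [mem_fullRC] at hp; omega⟩ : Fin n),
      (⟨p.1 + p.2 + 1, by rw [mem_fullRC] at hp; omega⟩ : Fin n)))
    (fun q _ => ((q.1 : ℕ), (q.2 : ℕ) - q.1 - 1)) ?_ ?_ ?_ ?_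
  · intro p hp
    simp only [Finset.mem_filter, Finset.mem_univ, true_and, w0, Fin.revPerm_apply, Fin.lt_def,
      Fin.val_rev] at hp ⊢
    rw [mem_fullRC] at hp
    omega
  · rintro ⟨⟨x, hx⟩, ⟨y, hy⟩⟩ hq
    simp only [Finset.mem_filter, Finset.mem_univ, true_and, Fin.lt_def] at hq
    simp only [mem_fullRC]
    omega
  · intro p hp
    ext
    · rfl
    · simp
      omega
  · rintro ⟨⟨x, hx⟩, ⟨y, hy⟩⟩ hq
    simp only [Finset.mem_filter, Finset.mem_univ, true_and, Fin.lt_def] at hq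
    simp only [Prod.mk.injEq, Fin.mk.injEq, true_and]
    omega

theorem invLength_mul_swap_of_cover {n : ℕ} {u : Perm' n} {i j : Fin n} (hij : i < j)
    (hu : u i < u j) (hm : ∀ m : Fin n, i < m → m < j → ¬(u i < u m ∧ u m < u j)) :
    invLength (u * Equiv.swap i j) = invLength u + 1 := by
  set t := Equiv.swap i j with ht
  set φ : Fin n × Fin n → Fin n × Fin n :=
    fun p => if t p.1 < t p.2 then (t p.1, t p.2) else p with hφ
  have hφφ : ∀ p : Fin n × Fin n, p.1 < p.2 → φ (φ p) = p := by
    intro p hp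
    by_cases h : t p.1 < t p.2
    · simp only [hφ, if_pos h]
      simp only [ht, Equiv.swap_apply_self, if_pos hp]
    · simp only [hφ, if_neg h]
  have hmem : (i, j) ∈ Finset.univ.filter
      (fun p : Fin n × Fin n => p.1 < p.2 ∧ (u * t) p.2 < (u * t) p.1) := by
    simp [ht, hij, hu]
  have key : ∀ p : Fin n × Fin n, p.1 < p.2 → p ≠ (i, j) →
      ((φ p).1 < (φ p).2 ∧ φ p ≠ (i, j) ∧
        ((u * t) (φ p).2 < (u * t) (φ p).1 ↔ u p.2 < u p.1)) := by
    rintro ⟨x, y⟩ hxy hne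
    by_cases h : t x < t y
    · simp only [hφ, h, if_true, Equiv.Perm.mul_apply, true_and]
      simp only [ht, Equiv.swap_apply_self, and_true]
      intro he
      rw [Prod.mk.injEq] at he
      have h₁ : x = j := by rw [← Equiv.swap_apply_self i j x, he.1, Equiv.swap_apply_left]
      have h₂ : y = i := by rw [← Equiv.swap_apply_self i j y, he.2, Equiv.swap_apply_right]
      subst h₁ h₂
      exact absurd hxy (not_lt.2 hij.le)
    · simp only [hφ, h, if_false, Equiv.Perm.mul_apply]
      refine ⟨hxy, hne, ?_⟩
      simp only at hxy h
      by_cases hxi : x = i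
      · subst hxi
        have hyj : y ≠ j := fun e => hne (by rw [e])
        have hty : t y = y := Equiv.swap_apply_of_ne_of_ne hxy.ne' hyj
        have htx : t x = j := Equiv.swap_apply_left x j
        rw [htx, hty] at h ⊢
        have := hm y hxy (lt_of_le_of_ne (not_lt.1 h) hyj)
        have := u.injective.ne hxy.ne
        grind
      · have hxj : x ≠ j := by
          rintro rfl
          have htx : t x = i := Equiv.swap_apply_right i x
          have hty : t y = y := Equiv.swap_apply_of_ne_of_ne (hij.trans hxy).ne' hxy.ne'
          rw [htx, hty] at h
          exact h (hij.trans hxy)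
        have htx : t x = x := Equiv.swap_apply_of_ne_of_ne hxi hxj
        by_cases hyj : y = j
        · subst hyj
          have hty : t y = i := Equiv.swap_apply_right i y
          rw [htx, hty] at h ⊢
          have := hm x (lt_of_le_of_ne (not_lt.1 h) (Ne.symm hxi)) hxy
          have := u.injective.ne hxy.ne
          grind
        · by_cases hyi : y = i
          · subst hyi
            have hty : t y = j := Equiv.swap_apply_left y j
            rw [htx, hty] at h
            exact absurd (hxy.trans hij) h
          · rw [htx, Equiv.swap_apply_of_ne_of_ne hyi hyj]
  unfold invLength
  rw [← Finset.card_erase_add_one hmem]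
  congr 1
  symm
  refine Finset.card_nbij' φ φ ?_ ?_ ?_ ?_
  · intro p hp
    simp only [Finset.coe_filter, Finset.mem_univ, true_and, Set.mem_ofPred_eq] at hp
    have hne : p ≠ (i, j) := by
      rintro rfl
      exact hu.not_gt hp.2
    have hk := key p hp.1 hne
    simp only [Finset.mem_coe, Finset.mem_erase, Finset.mem_filter, Finset.mem_univ, true_and]
    exact ⟨hk.2.1, hk.1, hk.2.2.2 hp.2⟩
  · intro p hp
    simp only [Finset.mem_coe, Finset.mem_erase, Finset.mem_filter, Finset.mem_univ,
      true_and] at hp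
    have hk := key p hp.2.1 hp.1
    have hk' := key (φ p) hk.1 hk.2.1
    rw [hφφ p hp.2.1] at hk'
    simp only [Finset.coe_filter, Finset.mem_univ, true_and, Set.mem_ofPred_eq]
    exact ⟨hk.1, hk'.2.2.1 hp.2.2⟩
  · intro p hp
    simp only [Finset.coe_filter, Finset.mem_univ, true_and, Set.mem_ofPred_eq] at hp
    exact hφφ p hp.1
  · intro p hp
    simp only [Finset.mem_coe, Finset.mem_erase, Finset.mem_filter, Finset.mem_univ,
      true_and] at hp
    exact hφφ p hp.2.1

/-- `v` agrees with `w₀` on the positions before `q.1`, and at `q.1` it either agrees with `w₀` or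
has a value greater than `q.2`. -/
def ReversedUpTo {n : ℕ} (q : ℕ × ℕ) (v : Perm' n) : Prop :=
  (∀ x : Fin n, (x : ℕ) < q.1 → (v x : ℕ) = n - 1 - x) ∧
    ∀ x : Fin n, (x : ℕ) = q.1 → q.2 < v x ∨ (v x : ℕ) = n - 1 - x

theorem val_le_of_forall_lt {n k : ℕ} {v : Perm' n}
    (h : ∀ x : Fin n, (x : ℕ) < k → (v x : ℕ) = n - 1 - x) {y : Fin n} (hy : k ≤ y) :
    (v y : ℕ) ≤ n - 1 - k := by
  by_contra! hlt
  have hn := (v y).isLt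
  have hx := h ⟨n - 1 - v y, by omega⟩ (by simp only; omega)
  have he : (⟨n - 1 - v y, by omega⟩ : Fin n) = y :=
    v.injective (Fin.ext (by rw [hx]; simp only; omega))
  have := congrArg Fin.val he
  simp only at this
  omega

theorem IsLabeledCover.of_reversedUpTo {n k b : ℕ} {u v : Perm' n}
    (h : IsLabeledCover u v k b) (hv : ReversedUpTo (k, b) v) :
    ∃ x y : Fin n, (x : ℕ) = k ∧ (v y : ℕ) = b ∧ u = v * Equiv.swap x y ∧ k + b + 2 ≤ n ∧
      (u x : ℕ) = b ∧ (∀ z : Fin n, (z : ℕ) < k → u z = v z) := by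
  obtain ⟨i, j, hij, hu, hm, rfl, hik, hkj, rfl⟩ := h
  obtain ⟨hlow, hk⟩ := hv
  simp only at hlow hk
  set v := u * Equiv.swap i j with hv
  have hvi : v i = u j := by simp [hv]
  have hvj : v j = u i := by simp [hv]
  have hvne : ∀ z, z ≠ i → z ≠ j → v z = u z := fun z h₁ h₂ => by
    simp [hv, Equiv.swap_apply_of_ne_of_ne h₁ h₂]
  have hjn := j.isLt
  set x : Fin n := ⟨k, by omega⟩ with hx
  have hxle : (v x : ℕ) ≤ n - 1 - k := val_le_of_forall_lt hlow le_rfl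
  have hxj : x ≠ j := fun e => by
    have := congrArg Fin.val e
    simp only [hx] at this
    omega
  have hlt : (u i : ℕ) < v x := by
    rcases hk x rfl with h | h
    · exact h
    · have h₁ : (v j : ℕ) ≤ n - 1 - k := val_le_of_forall_lt hlow hkj.le
      have h₂ : (v j : ℕ) ≠ v x := fun e => hxj (v.injective (Fin.ext e)).symm
      have hxk : (x : ℕ) = k := rfl
      rw [hvj] at h₁ h₂
      omega
  have hix : x = i := by
    by_contra hne
    have hilt : (i : ℕ) < k := by
      have : (i : ℕ) ≠ k := fun e => hne (Fin.ext e.symm)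
      omega
    have h₁ := hlow i hilt
    rw [hvi] at h₁
    rw [hvne x hne hxj] at hlt hxle
    refine hm x hilt hkj ⟨hlt, ?_⟩
    rw [Fin.lt_def]
    omega
  refine ⟨x, j, rfl, by rw [hvj], ?_, by omega, by rw [hix], fun z hz => ?_⟩
  · rw [hix, hv, mul_assoc, Equiv.swap_mul_self, mul_one]
  · refine (hvne z ?_ ?_).symm
    · rw [← hix]
      exact fun e => by simp [e, hx] at hz
    · exact fun e => by rw [e] at hz; omega

theorem IsLabeledCover.invLength_eq {n k b : ℕ} {u v : Perm' n} (h : IsLabeledCover u v k b) :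
    invLength v = invLength u + 1 := by
  obtain ⟨i, j, hij, hu, hm, rfl, -⟩ := h
  exact invLength_mul_swap_of_cover hij hu hm

/-- The valid positions that are not among the labels `γ.lab i` with `i ≥ t`. -/
def complementFrom {n m : ℕ} {u w : Perm' n} (γ : LabeledChain n m u w) (t : Fin (m + 1)) :
    Finset (ℕ × ℕ) :=
  (fullRC n).filter (fun p => ∀ i : Fin m, t ≤ i.castSucc → γ.lab i ≠ p)

theorem mem_complementFrom {n m : ℕ} {u w : Perm' n} {γ : LabeledChain n m u w}
    {t : Fin (m + 1)} {p : ℕ × ℕ} : p ∈ complementFrom γ t ↔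
      p.1 + p.2 + 2 ≤ n ∧ ∀ i : Fin m, t ≤ i.castSucc → γ.lab i ≠ p := by
  rw [complementFrom, Finset.mem_filter, mem_fullRC]

theorem complementFrom_castSucc {n m : ℕ} {u w : Perm' n} (γ : LabeledChain n m u w)
    (s : Fin m) : complementFrom γ s.castSucc = (complementFrom γ s.succ).erase (γ.lab s) := by
  ext p
  simp only [Finset.mem_erase, mem_complementFrom, Fin.castSucc_le_castSucc_iff,
    Fin.succ_le_castSucc_iff]
  constructor
  · exact fun ⟨h₁, h₂⟩ => ⟨(h₂ s le_rfl).symm, h₁, fun i hi => h₂ i hi.le⟩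
  · rintro ⟨h₁, h₂, h₃⟩
    refine ⟨h₂, fun i hi => ?_⟩
    rcases hi.eq_or_lt with rfl | hi
    · exact h₁.symm
    · exact h₃ i hi

theorem LabeledChain.Increasing.complementFrom_spec {n m : ℕ} {w : Perm' n}
    {γ : LabeledChain n m w (w0 n)} (hγ : γ.Increasing) (t : Fin (m + 1)) :
    rcPerm n (complementFrom γ t) = γ.c t ∧
      (complementFrom γ t).card = invLength (γ.c t) ∧
      ∀ q : ℕ × ℕ, (∀ s : Fin m, t ≤ s.castSucc → lexLt q (γ.lab s)) →
        ReversedUpTo q (γ.c t) := by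
  induction t using Fin.reverseInduction with
  | last =>
    have h : complementFrom γ (Fin.last m) = fullRC n := by
      ext p
      rw [mem_complementFrom, mem_fullRC]
      exact ⟨And.left, fun hp => ⟨hp, fun i hi => absurd hi (not_le.2 i.castSucc_lt_last)⟩⟩
    rw [h, γ.c_last, rcPerm_fullRC, invLength_w0]
    have hw : ∀ x : Fin n, (w0 n x : ℕ) = n - 1 - x := fun x => by
      rw [w0, Fin.revPerm_apply, Fin.val_rev]
      omega
    exact ⟨rfl, rfl, fun q _ => ⟨fun x _ => hw x, fun x _ => Or.inr (hw x)⟩⟩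
  | cast s ih =>
    obtain ⟨hperm, hcard, hrev⟩ := ih
    have hstep := γ.step s
    have hv := hrev (γ.lab s) fun i hi => hγ s i (Fin.succ_le_castSucc_iff.1 hi)
    obtain ⟨x, y, hx, hy, hu, hvalid, hux, hlow⟩ := hstep.of_reversedUpTo hv
    have hmem : γ.lab s ∈ complementFrom γ s.succ := by
      rw [mem_complementFrom]
      refine ⟨hvalid, fun i hi he => ?_⟩
      have := hγ s i (Fin.succ_le_castSucc_iff.1 hi)
      rw [he, lexLt] at this
      omega
    refine ⟨?_, ?_, fun q hq => ?_⟩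
    · rw [complementFrom_castSucc, hu, ← hperm]
      refine rcPerm_erase (fun p hp => (mem_complementFrom.1 hp).1) hvalid hmem ?_ hx
        (by rw [hperm, hy])
      intro q hq hlt
      rw [mem_complementFrom]
      refine ⟨mem_fullRC.1 hq, fun i hi he => ?_⟩
      have := hγ s i (Fin.succ_le_castSucc_iff.1 hi)
      rw [he] at this
      simp only [lexLt] at this hlt
      omega
    · have h₁ := hstep.invLength_eq
      rw [complementFrom_castSucc, Finset.card_erase_of_mem hmem, hcard]
      omega
    · have hlt := hq s le_rfl
      rw [lexLt] at hlt
      refine ⟨fun z hz => ?_, fun z hz => ?_⟩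
      · rw [hlow z (by omega)]
        exact hv.1 z (by omega)
      · rcases hlt with hlt | ⟨he, hlt⟩
        · rw [hlow z (by omega)]
          exact Or.inr (hv.1 z (by omega))
        · obtain rfl : z = x := Fin.ext (by omega)
          exact Or.inl (by omega)

/-- For an increasing chain `γ` from `w` to `w₀`, the set of valid
rc-positions which are not labels of covers in `γ` is an rc-graph associated to `w`. -/
theorem complement_of_labels_is_rc (n m : ℕ) (w : Perm' n)
    (γ : LabeledChain n m w (w0 n)) (hγ : γ.Increasing) :
    AssocRC n ((fullRC n).filter (fun p => ∀ i : Fin m, γ.lab i ≠ p)) w := by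
  have h : (fullRC n).filter (fun p => ∀ i : Fin m, γ.lab i ≠ p) = complementFrom γ 0 := by
    ext p
    simp [complementFrom]
  obtain ⟨hperm, hcard, -⟩ := hγ.complementFrom_spec 0
  rw [γ.c_zero] at hperm hcard
  rw [h]
  exact ⟨fun p hp => (mem_complementFrom.1 hp).1, hperm, hcard⟩
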